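/- Let c ∈ ℝ and let g : (c,∞) → ℝ be a continuous, bounded, monotone nonincreasing function with g(x) > 0 for all x > c, and suppose u(x, g(x)) = 0 for every x > c. Then f is identically zero on ℝ. -/

import Mathlib

open MeasureTheory Real

/-- The `n`-th moment of `f` against the Gaussian `exp (-s (x - y) ^ 2)` centred at `x`. -/
noncomputable def gaussMoment (f : ℝ → ℝ) (n : ℕ) (s x : ℝ) : ℝ :=
  ∫ y : ℝ, (x - y) ^ n * exp (-s * (x - y) ^ 2) * f y

/-- A power times a Gaussian is dominated by a wider Gaussian. -/
lemma exists_abs_pow_mul_exp_neg_mul_sq_le (n : ℕ) {s : ℝ} (hs : 0 < s) :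
    ∃ C : ℝ, 0 ≤ C ∧ ∀ p : ℝ,
      |p| ^ n * exp (-s * p ^ 2) ≤ C * exp (-(s / 2) * p ^ 2) := by
  refine ⟨1 + n.factorial / (s / 2) ^ n, by positivity, fun p => ?_⟩
  have hpow : |p| ^ n ≤ 1 + (p ^ 2) ^ n := by
    have h : (p ^ 2) ^ n = (|p| ^ n) ^ 2 := by rw [← sq_abs]; ring
    rw [h]
    nlinarith [sq_nonneg (|p| ^ n - 1), sq_nonneg (|p| ^ n)]
  have hexp : (p ^ 2) ^ n ≤ n.factorial / (s / 2) ^ n * exp (s / 2 * p ^ 2) := by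
    have h := pow_div_factorial_le_exp (x := s / 2 * p ^ 2) (by positivity) n
    rw [div_le_iff₀ (by positivity), mul_pow] at h
    rw [div_mul_eq_mul_div, le_div_iff₀ (by positivity)]
    linarith
  have hone : 1 ≤ exp (s / 2 * p ^ 2) := one_le_exp (by positivity)
  have hsplit : exp (-(s / 2) * p ^ 2) = exp (s / 2 * p ^ 2) * exp (-s * p ^ 2) := by
    rw [← exp_add]; ring_nf
  rw [hsplit, ← mul_assoc]
  gcongr
  linarith

/-- Moving the centre of a Gaussian by at most `1` costs a constant and half of the exponent. -/
lemma exp_neg_mul_sub_sq_le {s x x₀ : ℝ} (hs : 0 ≤ s) (hx : |x - x₀| ≤ 1) (y : ℝ) :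
    exp (-s * (x - y) ^ 2) ≤ exp s * exp (-(s / 2) * (x₀ - y) ^ 2) := by
  rw [← exp_add, exp_le_exp]
  have h1 : (x - x₀) ^ 2 ≤ 1 := by rw [← sq_abs]; nlinarith [abs_nonneg (x - x₀)]
  nlinarith [mul_nonneg hs (sub_nonneg.2 h1), mul_nonneg hs (sq_nonneg ((x - y) + (x - x₀)))]

/-- Local domination of the integrands defining `gaussMoment`. -/
lemma exists_integrable_bound_gaussMoment {f : ℝ → ℝ} {M : ℝ} (hM : ∀ x, |f x| ≤ M)
    (n : ℕ) {s₀ : ℝ} (hs₀ : 0 < s₀) (x₀ : ℝ) :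
    ∃ b : ℝ → ℝ, Integrable b ∧ ∀ s x, s₀ ≤ s → |x - x₀| ≤ 1 → ∀ y,
      ‖(x - y) ^ n * exp (-s * (x - y) ^ 2) * f y‖ ≤ b y := by
  obtain ⟨C, hC, hCb⟩ := exists_abs_pow_mul_exp_neg_mul_sq_le n hs₀
  have hM0 : 0 ≤ M := (abs_nonneg _).trans (hM 0)
  refine ⟨fun y => C * (exp (s₀ / 2) * exp (-(s₀ / 2 / 2) * (x₀ - y) ^ 2)) * M, ?_, ?_⟩
  · have h := (integrable_exp_neg_mul_sq (b := s₀ / 2 / 2) (by positivity)).comp_sub_left x₀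
    exact ((h.const_mul _).const_mul _).mul_const _
  · intro s x hs hx y
    rw [norm_mul, norm_mul, norm_pow, norm_eq_abs, norm_eq_abs, norm_eq_abs, abs_exp]
    have h1 : exp (-s * (x - y) ^ 2) ≤ exp (-s₀ * (x - y) ^ 2) := by
      rw [exp_le_exp]; nlinarith [mul_nonneg (sub_nonneg.2 hs) (sq_nonneg (x - y))]
    have h2 := exp_neg_mul_sub_sq_le (s := s₀ / 2) (by positivity) hx y
    calc |x - y| ^ n * exp (-s * (x - y) ^ 2) * |f y|
        ≤ |x - y| ^ n * exp (-s₀ * (x - y) ^ 2) * M := by gcongr; exact hM y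
      _ ≤ C * exp (-(s₀ / 2) * (x - y) ^ 2) * M :=
          mul_le_mul_of_nonneg_right (hCb _) hM0
      _ ≤ _ := mul_le_mul_of_nonneg_right (mul_le_mul_of_nonneg_left h2 hC) hM0

lemma aestronglyMeasurable_gaussMoment {f : ℝ → ℝ} (hf : Continuous f) (n : ℕ) (s x : ℝ) :
    AEStronglyMeasurable (fun y => (x - y) ^ n * exp (-s * (x - y) ^ 2) * f y) volume :=
  Continuous.aestronglyMeasurable (by fun_prop)

lemma integrable_gaussMoment {f : ℝ → ℝ} {M : ℝ} (hf : Continuous f) (hM : ∀ x, |f x| ≤ M)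
    (n : ℕ) {s : ℝ} (hs : 0 < s) (x : ℝ) :
    Integrable (fun y => (x - y) ^ n * exp (-s * (x - y) ^ 2) * f y) := by
  obtain ⟨b, hb, hle⟩ := exists_integrable_bound_gaussMoment hM n hs x
  exact hb.mono' (aestronglyMeasurable_gaussMoment hf n s x)
    (.of_forall fun y => hle s x le_rfl (by simp) y)

lemma continuousAt_gaussMoment {f : ℝ → ℝ} {M : ℝ} (hf : Continuous f) (hM : ∀ x, |f x| ≤ M)
    (n : ℕ) {s : ℝ} (hs : 0 < s) (x : ℝ) :
    ContinuousAt (fun p : ℝ × ℝ => gaussMoment f n p.1 p.2) (s, x) := by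
  obtain ⟨b, hb, hle⟩ := exists_integrable_bound_gaussMoment hM n (half_pos hs) x
  refine continuousAt_of_dominated
    (.of_forall fun p => aestronglyMeasurable_gaussMoment hf n p.1 p.2) ?_ hb
    (.of_forall fun y => Continuous.continuousAt (by fun_prop))
  have hnhds : Set.Ici (s / 2) ×ˢ Metric.closedBall x 1 ∈ nhds (s, x) :=
    prod_mem_nhds (Ici_mem_nhds (by linarith)) (Metric.closedBall_mem_nhds x one_pos)
  filter_upwards [hnhds] with p hp
  exact .of_forall fun y => hle p.1 p.2 hp.1 (by simpa [Real.dist_eq] using hp.2) y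

lemma hasDerivAt_gaussMoment_right {f : ℝ → ℝ} {M : ℝ} (hf : Continuous f)
    (hM : ∀ x, |f x| ≤ M) (n : ℕ) {s : ℝ} (hs : 0 < s) (x : ℝ) :
    HasDerivAt (gaussMoment f n s)
      (n * gaussMoment f (n - 1) s x - 2 * s * gaussMoment f (n + 1) s x) x := by
  obtain ⟨b₁, hb₁, hle₁⟩ := exists_integrable_bound_gaussMoment hM (n - 1) hs x
  obtain ⟨b₂, hb₂, hle₂⟩ := exists_integrable_bound_gaussMoment hM (n + 1) hs x
  have key := hasDerivAt_integral_of_dominated_loc_of_deriv_le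
    (μ := volume) (F := fun x y => (x - y) ^ n * exp (-s * (x - y) ^ 2) * f y)
    (F' := fun x y => n * ((x - y) ^ (n - 1) * exp (-s * (x - y) ^ 2) * f y)
      - 2 * s * ((x - y) ^ (n + 1) * exp (-s * (x - y) ^ 2) * f y))
    (bound := fun y => n * b₁ y + 2 * s * b₂ y)
    (Metric.closedBall_mem_nhds x one_pos)
    (.of_forall fun x => aestronglyMeasurable_gaussMoment hf n s x)
    (integrable_gaussMoment hf hM n hs x)
    (((aestronglyMeasurable_gaussMoment hf _ s x).const_mul _).sub
      ((aestronglyMeasurable_gaussMoment hf _ s x).const_mul _))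
    (.of_forall fun y z hz => ?_) ((hb₁.const_mul _).add (hb₂.const_mul _))
    (.of_forall fun y z hz => ?_)
  · have h := key.2
    rwa [integral_sub ((integrable_gaussMoment hf hM _ hs x).const_mul _)
      ((integrable_gaussMoment hf hM _ hs x).const_mul _), integral_const_mul,
      integral_const_mul] at h
  · have hz' : |z - x| ≤ 1 := by simpa [Real.dist_eq] using hz
    refine (norm_sub_le _ _).trans ?_
    rw [norm_mul, norm_mul (2 * s), norm_of_nonneg (Nat.cast_nonneg n),
      norm_of_nonneg (by positivity : 0 ≤ 2 * s)]
    gcongr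
    · exact hle₁ s z le_rfl hz' y
    · exact hle₂ s z le_rfl hz' y
  · have h1 : HasDerivAt (fun x => x - y) 1 z := (hasDerivAt_id z).sub_const y
    have h2 := ((h1.pow n).mul ((h1.pow 2).const_mul (-s)).exp).mul_const (f y)
    refine h2.congr_deriv ?_
    simp only [Pi.pow_apply]
    push_cast
    ring

lemma hasDerivAt_gaussMoment_left {f : ℝ → ℝ} {M : ℝ} (hf : Continuous f)
    (hM : ∀ x, |f x| ≤ M) (n : ℕ) {s : ℝ} (hs : 0 < s) (x : ℝ) :
    HasDerivAt (fun s => gaussMoment f n s x) (-gaussMoment f (n + 2) s x) s := by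
  obtain ⟨b, hb, hle⟩ := exists_integrable_bound_gaussMoment hM (n + 2) (half_pos hs) x
  have key := hasDerivAt_integral_of_dominated_loc_of_deriv_le
    (μ := volume) (F := fun s y => (x - y) ^ n * exp (-s * (x - y) ^ 2) * f y)
    (F' := fun s y => -((x - y) ^ (n + 2) * exp (-s * (x - y) ^ 2) * f y))
    (Ici_mem_nhds (half_lt_self hs))
    (.of_forall fun s => aestronglyMeasurable_gaussMoment hf n s x)
    (integrable_gaussMoment hf hM n hs x)
    (aestronglyMeasurable_gaussMoment hf _ s x).neg
    (.of_forall fun y z hz => ?_) hb (.of_forall fun y z hz => ?_)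
  · have h := key.2
    rwa [integral_neg] at h
  · rw [norm_neg]
    exact hle z x hz (by simp) y
  · have h2 := ((((hasDerivAt_id z).neg.mul_const ((x - y) ^ 2)).exp.const_mul
      ((x - y) ^ n)).mul_const (f y))
    refine h2.congr_deriv ?_
    simp only [Pi.neg_apply, id]
    ring

lemma gaussMoment_neg (f : ℝ → ℝ) (n : ℕ) (s x : ℝ) :
    gaussMoment (fun y => -f y) n s x = -gaussMoment f n s x := by
  simp only [gaussMoment, mul_neg, integral_neg]

lemma abs_gaussMoment_zero_le {f : ℝ → ℝ} {M : ℝ} (hM : ∀ x, |f x| ≤ M) {s : ℝ} (hs : 0 < s)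
    (x : ℝ) : |gaussMoment f 0 s x| ≤ √(π / s) * M := by
  have hint : Integrable fun y : ℝ => exp (-s * (x - y) ^ 2) :=
    (integrable_exp_neg_mul_sq hs).comp_sub_left x
  have hval : ∫ y : ℝ, exp (-s * (x - y) ^ 2) = √(π / s) := by
    rw [integral_sub_left_eq_self (fun y : ℝ => exp (-s * y ^ 2)), integral_gaussian]
  rw [← hval, ← integral_mul_const, ← norm_eq_abs]
  refine norm_integral_le_of_norm_le (hint.mul_const M) (.of_forall fun y => ?_)
  rw [pow_zero, one_mul, norm_mul, norm_eq_abs, norm_eq_abs, abs_exp]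
  gcongr
  exact hM y

/-- The second derivative is nonpositive at a local maximum. -/
lemma IsLocalMax.second_deriv_nonpos {φ φ' : ℝ → ℝ} {d x : ℝ} (h : IsLocalMax φ x)
    (h₁ : ∀ z, HasDerivAt φ (φ' z) z) (h₂ : HasDerivAt φ' d x) : d ≤ 0 := by
  by_contra! hd
  have hderiv : deriv φ = φ' := funext fun z => (h₁ z).deriv
  have hmin : IsLocalMin φ x := isLocalMin_of_deriv_deriv_pos (by rwa [hderiv, h₂.deriv])
    h.deriv_eq_zero (h₁ x).continuousAt
  have hconst : φ =ᶠ[nhds x] fun _ => φ x := by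
    filter_upwards [h, hmin] with z hz hz' using le_antisymm hz hz'
  have hzero := hconst.deriv.deriv_eq
  rw [hderiv, h₂.deriv] at hzero
  simp at hzero
  exact hd.ne' hzero

/-- The derivative is nonnegative at a point that is maximal among nearby points on its left. -/
lemma HasDerivAt.nonneg_of_eventually_le_left {ψ : ℝ → ℝ} {d t : ℝ} (hd : HasDerivAt ψ d t)
    (h : ∀ᶠ r in nhdsWithin t (Set.Iio t), ψ r ≤ ψ t) : 0 ≤ d := by
  refine ge_of_tendsto (hasDerivAt_iff_tendsto_slope_left_right.1 hd).1 ?_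
  filter_upwards [h, self_mem_nhdsWithin] with r hr hrt
  rw [slope_def_field]
  exact div_nonneg_of_nonpos (sub_nonpos.2 hr) (sub_nonpos.2 (le_of_lt hrt))

/-- A maximum principle: a solution of the heat equation that is bounded above, and nonpositive on
the graph of a positive nonincreasing function on `[a, ∞)`, is nonpositive on the half-line
starting at the left end of the graph. -/
lemma heat_nonpos_of_antitone_graph {v vx vt : ℝ → ℝ → ℝ} {M : ℝ}
    (hbdd : ∀ x t, 0 < t → v x t ≤ M)
    (hcont : ∀ x t, 0 < t → ContinuousAt (fun p : ℝ × ℝ => v p.1 p.2) (x, t))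
    (hx : ∀ x t, 0 < t → HasDerivAt (fun x => v x t) (vx x t) x)
    (hxx : ∀ x t, 0 < t → HasDerivAt (fun x => vx x t) (vt x t) x)
    (ht : ∀ x t, 0 < t → HasDerivAt (fun t => v x t) (vt x t) t)
    {a : ℝ} {g : ℝ → ℝ} (hg_cont : ContinuousOn g (Set.Ici a))
    (hg_pos : ∀ x, a ≤ x → 0 < g x) (hg_anti : AntitoneOn g (Set.Ici a))
    (hgraph : ∀ x, a ≤ x → v x (g x) ≤ 0) (x : ℝ) (hax : a ≤ x) : v x (g a) ≤ 0 := by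
  suffices h : ∀ ε > 0, v x (g a) ≤ ε * exp (x + 2 * g a) by
    refine le_of_forall_pos_le_add fun δ hδ => ?_
    have := h (δ / exp (x + 2 * g a)) (by positivity)
    rwa [div_mul_cancel₀ _ (exp_pos _).ne', ← zero_add δ] at this
  intro ε hε
  by_contra! hlt
  set R := max x (M / ε) with hR
  have hxR : x ≤ R := le_max_left _ _
  have haR : a ≤ R := hax.trans hxR
  have hMR : M ≤ ε * exp R := by
    have h1 : M / ε ≤ exp R := (le_max_right _ _).trans
      ((le_add_of_nonneg_right zero_le_one).trans (add_one_le_exp R))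
    rwa [div_le_iff₀' hε] at h1
  set w : ℝ × ℝ → ℝ := fun p => v p.1 p.2 - ε * exp (p.1 + 2 * p.2) with hw
  set K : Set (ℝ × ℝ) := {p ∈ Set.Icc a R ×ˢ Set.Icc (g R) (g a) | g p.1 ≤ p.2} with hK
  have hbox : IsCompact (Set.Icc a R ×ˢ Set.Icc (g R) (g a)) := isCompact_Icc.prod isCompact_Icc
  have hgc : ContinuousOn (fun p : ℝ × ℝ => g p.1) (Set.Icc a R ×ˢ Set.Icc (g R) (g a)) :=
    hg_cont.comp continuousOn_fst fun p hp => hp.1.1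
  have hKcomp : IsCompact K :=
    hbox.of_isClosed_subset (hbox.isClosed.isClosed_le hgc continuousOn_snd) fun p hp => hp.1
  have hKmem : ∀ z t, a ≤ z → z ≤ R → g z ≤ t → t ≤ g a → (z, t) ∈ K := fun z t h1 h2 h3 h4 =>
    ⟨⟨⟨h1, h2⟩, (hg_anti h1 haR h2).trans h3, h4⟩, h3⟩
  have hwc : ContinuousOn w K := fun p hp =>
    ((hcont p.1 p.2 ((hg_pos R haR).trans_le hp.1.2.1)).sub
      (Continuous.continuousAt (by fun_prop))).continuousWithinAt
  have hxK : (x, g a) ∈ K := hKmem x _ hax hxR (hg_anti Set.self_mem_Ici hax hax) le_rfl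
  obtain ⟨⟨y, t⟩, hyK, hmax⟩ := hKcomp.exists_isMaxOn ⟨_, hxK⟩ hwc
  have hwpos : 0 < w (y, t) := (sub_pos.2 hlt).trans_le (hmax hxK)
  have hmax' : ∀ p ∈ K, w p ≤ w (y, t) := hmax
  obtain ⟨⟨⟨hay, hyR⟩, hgt, hta⟩, hgyt⟩ := hyK
  simp only at hay hyR hgt hta hgyt
  have ht0 : 0 < t := (hg_pos R haR).trans_le hgt
  have hgyt' : g y < t := by
    refine lt_of_le_of_ne hgyt fun heq => ?_
    have h1 := hgraph y hay
    have h2 : 0 < ε * exp (y + 2 * t) := by positivity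
    simp only [hw] at hwpos
    rw [heq] at h1
    linarith
  have hay' : a < y := by
    refine lt_of_le_of_ne hay fun heq => ?_
    rw [← heq] at hgyt'
    linarith
  have hyR' : y < R := by
    refine lt_of_le_of_ne hyR fun heq => ?_
    have h1 := hbdd y t ht0
    have h2 : exp R ≤ exp (y + 2 * t) := exp_le_exp.2 (by linarith)
    have h3 := mul_le_mul_of_nonneg_left h2 hε.le
    simp only [hw] at hwpos
    linarith
  have hspace : vt y t - ε * exp (y + 2 * t) ≤ 0 := by
    have hE : ∀ z, HasDerivAt (fun z => ε * exp (z + 2 * t)) (ε * exp (z + 2 * t)) z := fun z => by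
      simpa using (((hasDerivAt_id z).add_const (2 * t)).exp.const_mul ε)
    have hloc : IsLocalMax (fun z => v z t - ε * exp (z + 2 * t)) y := by
      have hgy : ContinuousAt g y := hg_cont.continuousAt (Ici_mem_nhds hay')
      filter_upwards [Ioo_mem_nhds hay' hyR', hgy.eventually_lt continuousAt_const hgyt']
        with z hz hgz
      exact hmax' (z, t) (hKmem z t hz.1.le hz.2.le hgz.le hta)
    exact hloc.second_deriv_nonpos (fun z => (hx z t ht0).sub (hE z)) ((hxx y t ht0).sub (hE y))
  have htime : 0 ≤ vt y t - ε * (exp (y + 2 * t) * 2) := by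
    have hE : HasDerivAt (fun r => ε * exp (y + 2 * r)) (ε * (exp (y + 2 * t) * 2)) t := by
      simpa using ((((hasDerivAt_id t).const_mul 2).const_add y).exp.const_mul ε)
    refine ((ht y t ht0).sub hE).nonneg_of_eventually_le_left ?_
    filter_upwards [Ioo_mem_nhdsLT hgyt'] with r hr
    exact hmax' (y, r) (hKmem y r hay hyR hr.1.le (hr.2.le.trans hta))
  have : 0 < ε * exp (y + 2 * t) := by positivity
  linarith

lemma gaussMoment_nonpos_of_antitone_graph {f : ℝ → ℝ} {M : ℝ} (hf : Continuous f)
    (hM : ∀ x, |f x| ≤ M) {a : ℝ} {g : ℝ → ℝ} (hg_cont : ContinuousOn g (Set.Ici a))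
    (hg_pos : ∀ x, a ≤ x → 0 < g x) (hg_anti : AntitoneOn g (Set.Ici a))
    (hgraph : ∀ x, a ≤ x → gaussMoment f 0 (1 / (4 * g x)) x ≤ 0) (x : ℝ) (hax : a ≤ x) :
    gaussMoment f 0 (1 / (4 * g a)) x ≤ 0 := by
  have hs : ∀ {t : ℝ}, 0 < t → 0 < 1 / (4 * t) := fun ht => by positivity
  have hc : ∀ {t : ℝ}, 0 < t → 0 < (√(4 * π * t))⁻¹ := fun ht => by positivity
  have key := heat_nonpos_of_antitone_graph (M := M)
    (v := fun x t => (√(4 * π * t))⁻¹ * gaussMoment f 0 (1 / (4 * t)) x)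
    (vx := fun x t => (√(4 * π * t))⁻¹ * (-(1 / (2 * t)) * gaussMoment f 1 (1 / (4 * t)) x))
    (vt := fun x t => (√(4 * π * t))⁻¹ * (-(1 / (2 * t)) *
      (gaussMoment f 0 (1 / (4 * t)) x - 1 / (2 * t) * gaussMoment f 2 (1 / (4 * t)) x)))
    ?_ ?_ ?_ ?_ ?_ hg_cont hg_pos hg_anti ?_ x hax
  · exact nonpos_of_mul_nonpos_right key (hc (hg_pos a le_rfl))
  · intro x t ht
    have h := (le_abs_self _).trans (abs_gaussMoment_zero_le hM (hs ht) x)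
    rw [show π / (1 / (4 * t)) = 4 * π * t by field_simp] at h
    exact (inv_mul_le_iff₀ (by positivity)).2 h
  · intro x t ht
    have hmap : ContinuousAt (fun p : ℝ × ℝ => (1 / (4 * p.2), p.1)) (x, t) := by
      refine ContinuousAt.prodMk (continuousAt_const.div (by fun_prop) ?_) continuousAt_fst
      positivity
    have hF : ContinuousAt (fun p : ℝ × ℝ => gaussMoment f 0 (1 / (4 * p.2)) p.1) (x, t) :=
      ContinuousAt.comp' (f := fun p : ℝ × ℝ => (1 / (4 * p.2), p.1)) (x := (x, t))
        (continuousAt_gaussMoment hf hM 0 (hs ht) x) hmap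
    refine ContinuousAt.mul (ContinuousAt.inv₀ (by fun_prop) ?_) hF
    positivity
  · intro x t ht
    refine ((hasDerivAt_gaussMoment_right hf hM 0 (hs ht) x).const_mul _).congr_deriv ?_
    field_simp
    simp
    ring
  · intro x t ht
    refine (((hasDerivAt_gaussMoment_right hf hM 1 (hs ht) x).const_mul _).const_mul _).congr_deriv
      ?_
    simp only [Nat.cast_one, Nat.sub_self, one_mul]
    field_simp
    ring
  · intro x t ht
    have hsq : HasDerivAt (fun t => (√(4 * π * t))⁻¹) (-(1 / (2 * t)) * (√(4 * π * t))⁻¹) t := by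
      have h := (((hasDerivAt_id t).const_mul (4 * π)).sqrt (by simp; positivity)).inv
        (by simp only [id]; positivity)
      refine h.congr_deriv ?_
      have hsq' : √(4 * π * t) ^ 2 = 4 * π * t := sq_sqrt (by positivity)
      simp only [id]
      rw [hsq']
      field_simp
    have hinv : HasDerivAt (fun t : ℝ => 1 / (4 * t)) (-(1 / (4 * t ^ 2))) t := by
      have h := ((hasDerivAt_id t).const_mul 4).inv (by simp; positivity)
      simp only [one_div]
      refine h.congr_deriv ?_
      simp only [id]
      field_simp
    have hF := (hasDerivAt_gaussMoment_left hf hM 0 (hs ht) x).comp t hinv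
    refine (hsq.mul hF).congr_deriv ?_
    simp only [Function.comp]
    field_simp
    ring
  · exact fun x hx => mul_nonpos_of_nonneg_of_nonpos (hc (hg_pos x hx)).le (hgraph x hx)

lemma exp_mul_sq_mul_exp_neg_mul_sub_sq {s : ℝ} (hs : s ≠ 0) (r y : ℝ) :
    exp (s * (r / (2 * s)) ^ 2) * exp (-s * (r / (2 * s) - y) ^ 2)
      = exp (-s * y ^ 2) * exp (r * y) := by
  rw [← exp_add, ← exp_add]
  congr 1
  field_simp
  ring

lemma integrable_exp_mul_mul_exp_neg_mul_sq_mul {f : ℝ → ℝ} {M : ℝ} (hf : Continuous f)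
    (hM : ∀ x, |f x| ≤ M) {s : ℝ} (hs : 0 < s) (r : ℝ) :
    Integrable fun y => exp (-s * y ^ 2) * f y * exp (r * y) := by
  refine ((integrable_gaussMoment hf hM 0 hs (r / (2 * s))).const_mul
    (exp (s * (r / (2 * s)) ^ 2))).congr (.of_forall fun y => ?_)
  simp only [pow_zero, one_mul]
  rw [← mul_assoc, exp_mul_sq_mul_exp_neg_mul_sub_sq hs.ne']
  ring

open ProbabilityTheory in
/-- Finite measures on the line whose moment generating functions are finite everywhere and agree
near one point are equal. -/
lemma MeasureTheory.Measure.ext_of_mgf_id_eventuallyEq {μ ν : Measure ℝ} [IsFiniteMeasure μ]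
    [IsFiniteMeasure ν] (hμ : integrableExpSet id μ = Set.univ)
    (hν : integrableExpSet id ν = Set.univ) {r : ℝ} (h : mgf id μ =ᶠ[nhds r] mgf id ν) :
    μ = ν := by
  have hmgf : mgf id μ = mgf id ν := by
    refine AnalyticOnNhd.eq_of_eventuallyEq (𝕜 := ℝ) ?_ ?_ h
    · simpa [hμ] using analyticOnNhd_mgf (X := id) (μ := μ)
    · simpa [hν] using analyticOnNhd_mgf (X := id) (μ := ν)
  have hzero : μ = 0 ↔ ν = 0 := by
    have h0 := congrFun hmgf 0
    rw [mgf_zero', mgf_zero'] at h0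
    rw [← Measure.measure_univ_eq_zero, ← Measure.measure_univ_eq_zero,
      ← measureReal_eq_zero_iff, ← measureReal_eq_zero_iff, h0]
  refine Measure.ext_of_complexMGF_id_eq (funext fun z => ?_)
  exact eqOn_complexMGF_of_mgf' hmgf hzero (by simp [hμ])

open ProbabilityTheory in
lemma mgf_id_withDensity_gaussian_mul {f : ℝ → ℝ} {M : ℝ} (hf : Continuous f)
    (hM : ∀ x, |f x| ≤ M) (hf0 : ∀ x, 0 ≤ f x) {s : ℝ} (hs : 0 < s) :
    let μ := volume.withDensity fun y => ENNReal.ofReal (exp (-s * y ^ 2) * f y)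
    IsFiniteMeasure μ ∧ integrableExpSet id μ = Set.univ ∧
      ∀ r, mgf id μ r = ∫ y, exp (-s * y ^ 2) * f y * exp (r * y) := by
  intro μ
  have hint := integrable_exp_mul_mul_exp_neg_mul_sq_mul hf hM hs
  have hmeas : Measurable fun y => ENNReal.ofReal (exp (-s * y ^ 2) * f y) := by fun_prop
  have hreal : ∀ y, (ENNReal.ofReal (exp (-s * y ^ 2) * f y)).toReal = exp (-s * y ^ 2) * f y :=
    fun y => ENNReal.toReal_ofReal (mul_nonneg (exp_pos _).le (hf0 y))
  refine ⟨?_, Set.eq_univ_of_forall fun r => ?_, fun r => ?_⟩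
  · have h := hint 0
    simp only [zero_mul, exp_zero, mul_one] at h
    exact isFiniteMeasure_withDensity_ofReal h.2
  · refine (integrable_withDensity_iff_integrable_smul' hmeas
      (.of_forall fun y => ENNReal.ofReal_lt_top)).2 ?_
    exact (hint r).congr (.of_forall fun y => by simp only [hreal, smul_eq_mul, id])
  · rw [mgf, integral_withDensity_eq_integral_toReal_smul hmeas
      (.of_forall fun y => ENNReal.ofReal_lt_top)]
    simp only [hreal, smul_eq_mul, id]

/-- A bounded continuous function whose Gaussian convolution vanishes on a half-line is zero. -/
lemma eq_zero_of_gaussMoment_eq_zero {f : ℝ → ℝ} {M : ℝ} (hf : Continuous f)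
    (hM : ∀ x, |f x| ≤ M) {s : ℝ} (hs : 0 < s) {a : ℝ}
    (h : ∀ x, a ≤ x → gaussMoment f 0 s x = 0) (x : ℝ) : f x = 0 := by
  have hp : Continuous fun y => max (f y) 0 := by fun_prop
  have hn : Continuous fun y => max (-f y) 0 := by fun_prop
  have hpM : ∀ y, |max (f y) 0| ≤ M := fun y => by
    rw [abs_of_nonneg (le_max_right _ _)]
    exact (max_le (le_abs_self _) (abs_nonneg _)).trans (hM y)
  have hnM : ∀ y, |max (-f y) 0| ≤ M := fun y => by
    rw [abs_of_nonneg (le_max_right _ _)]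
    exact (max_le (neg_le_abs _) (abs_nonneg _)).trans (hM y)
  obtain ⟨hfp, hup, hmp⟩ := mgf_id_withDensity_gaussian_mul hp hpM (fun _ => le_max_right _ _) hs
  obtain ⟨hfn, hun, hmn⟩ := mgf_id_withDensity_gaussian_mul hn hnM (fun _ => le_max_right _ _) hs
  have hsub : ∀ y, max (f y) 0 - max (-f y) 0 = f y := fun y =>
    max_zero_sub_max_neg_zero_eq_self (f y)
  have hmeas := Measure.ext_of_mgf_id_eventuallyEq hup hun (r := 2 * s * (a + 1)) (by
    filter_upwards [Ioi_mem_nhds (by nlinarith : 2 * s * a < 2 * s * (a + 1))] with r hr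
    have har : a ≤ r / (2 * s) := by
      rw [le_div_iff₀' (by positivity)]
      exact le_of_lt hr
    rw [hmp, hmn, ← sub_eq_zero, ← integral_sub
      (integrable_exp_mul_mul_exp_neg_mul_sq_mul hp hpM hs r)
      (integrable_exp_mul_mul_exp_neg_mul_sq_mul hn hnM hs r)]
    have hgauss := congrArg (exp (s * (r / (2 * s)) ^ 2) * ·) (h _ har)
    simp only [gaussMoment, mul_zero, pow_zero, one_mul] at hgauss
    refine Eq.trans ?_ ((integral_const_mul _ _).trans hgauss)
    refine integral_congr_ae (.of_forall fun y => ?_)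
    simp only
    rw [← mul_assoc (exp (s * _)), exp_mul_sq_mul_exp_neg_mul_sub_sq hs.ne', ← sub_mul, ← mul_sub, hsub]
    ring)
  rw [withDensity_eq_iff_of_sigmaFinite (by fun_prop) (by fun_prop)] at hmeas
  have hae : f =ᵐ[volume] fun _ => 0 := by
    filter_upwards [hmeas] with y hy
    rw [ENNReal.ofReal_eq_ofReal_iff (by positivity) (by positivity)] at hy
    rw [← hsub y, mul_left_cancel₀ (exp_pos _).ne' hy, sub_self]
  exact congrFun (hf.ae_eq_iff_eq volume continuous_const |>.1 hae) x

/-- If `u` vanishes on the graph of a positive, bounded, continuous, monotone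
nonincreasing function `g` on `(c,∞)`, then the initial data `f` vanishes
identically. -/
theorem heat_graph_antitone
    (f : ℝ → ℝ) (hf_cont : Continuous f) (M : ℝ) (hf_bdd : ∀ x, |f x| ≤ M)
    (u : ℝ → ℝ → ℝ)
    (hu : ∀ x t, 0 < t →
      u x t = (Real.sqrt (4 * Real.pi * t))⁻¹ *
        ∫ y : ℝ, Real.exp (-((x - y) ^ 2) / (4 * t)) * f y)
    (hu0 : ∀ x, u x 0 = f x)
    (c : ℝ) (g : ℝ → ℝ) (hg_cont : ContinuousOn g (Set.Ioi c))
    (hg_pos : ∀ x, c < x → 0 < g x)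
    (B : ℝ) (hg_bdd : ∀ x, c < x → g x ≤ B)
    (hg_anti : AntitoneOn g (Set.Ioi c))
    (hvanish : ∀ x, c < x → u x (g x) = 0) :
    ∀ x : ℝ, f x = 0 := by
  have hgraph : ∀ x, c + 1 ≤ x → gaussMoment f 0 (1 / (4 * g x)) x = 0 := fun x hx => by
    have hcx : c < x := by linarith
    have hg := hg_pos x hcx
    have h := hvanish x hcx
    rw [hu x _ hg, mul_eq_zero, or_iff_right (by positivity)] at h
    rw [← h, gaussMoment]
    refine integral_congr_ae (.of_forall fun y => ?_)
    simp only [pow_zero, one_mul]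
    ring_nf
  have hsub : Set.Ici (c + 1) ⊆ Set.Ioi c := Set.Ici_subset_Ioi.2 (by linarith)
  have hpos : ∀ x, c + 1 ≤ x → 0 < g x := fun x hx => hg_pos x (hsub hx)
  have hslice : ∀ x, c + 1 ≤ x → gaussMoment f 0 (1 / (4 * g (c + 1))) x = 0 := fun x hx => by
    refine le_antisymm (gaussMoment_nonpos_of_antitone_graph hf_cont hf_bdd (hg_cont.mono hsub)
      hpos (hg_anti.mono hsub) (fun z hz => (hgraph z hz).le) x hx) ?_
    have h := gaussMoment_nonpos_of_antitone_graph (f := fun y => -f y) (M := M) hf_cont.neg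
      (by simpa using hf_bdd) (hg_cont.mono hsub) hpos (hg_anti.mono hsub)
      (fun z hz => by rw [gaussMoment_neg, hgraph z hz, neg_zero]) x hx
    rw [gaussMoment_neg] at h
    linarith
  have hg1 := hpos (c + 1) le_rfl
  exact eq_zero_of_gaussMoment_eq_zero hf_cont hf_bdd (by positivity) hslice
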